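/- Let {φ_i ⊗ ψ_i}_{i=1}^5 be a general Unextendible Product Basis in ℂ^3 ⊗ ℂ^3 (five nonzero product vectors such that no nonzero product vector is orthogonal to all of them). If ρ_1 and ρ_2 are PPT states on ℂ^3 ⊗ ℂ^3 such that φ_i ⊗ ψ_i lies in the kernel of ρ_1 and in the kernel of ρ_2 for every i = 1, …, 5, then there exists a positive real number λ with ρ_2 = λ·ρ_1. -/

import Mathlib

open scoped ComplexConjugate ComplexOrder

/-- The standard Hermitian inner product, conjugate-linear in the first argument. -/
noncomputable def hinner {α : Type*} [Fintype α] (x y : α → ℂ) : ℂ :=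
  ∑ a, conj (x a) * y a

/-- The product vector `φ ⊗ ψ` in `ℂ^n ⊗ ℂ^m`, identified with `Fin n × Fin m → ℂ`. -/
noncomputable def prodVec {n m : ℕ} (φ : Fin n → ℂ) (ψ : Fin m → ℂ) :
    Fin n × Fin m → ℂ :=
  fun p => φ p.1 * ψ p.2

/-- The partial transpose with respect to the first subsystem:
`ρ^{T1}((i,j),(k,l)) = ρ((k,j),(i,l))`. -/
noncomputable def pt {n m : ℕ} (ρ : Matrix (Fin n × Fin m) (Fin n × Fin m) ℂ) :
    Matrix (Fin n × Fin m) (Fin n × Fin m) ℂ :=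
  Matrix.of fun a b => ρ (b.1, a.2) (a.1, b.2)

open Matrix

/-- The linear relations satisfied by a Hermitian matrix on `ℂ^3 ⊗ ℂ^3` whose kernel contains
`e_k ⊗ e_k`, `(1,1,1) ⊗ (1,1,1)` and `a ⊗ p`, and whose partial transpose is killed by all
`e_k ⊗ e_k`. -/
structure HexRelations (a p : Fin 3 → ℂ) (N : Matrix (Fin 3 × Fin 3) (Fin 3 × Fin 3) ℂ) :
    Prop where
  herm : ∀ x y, star (N y x) = N x y
  diag : ∀ x k, N x (k, k) = 0
  cross : ∀ i j k, N (k, j) (i, k) = 0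
  sum_one : ∀ x, ∑ y, N x y = 0
  sum_vec : ∀ x, ∑ y, N x y * (a y.1 * p y.2) = 0

lemma Fin.sum_univ_three_of_ne {M : Type*} [AddCommMonoid M] {i j k : Fin 3} (hij : i ≠ j)
    (hik : i ≠ k) (hjk : j ≠ k) (f : Fin 3 → M) : ∑ x, f x = f i + f j + f k := by
  have h : (Finset.univ : Finset (Fin 3)) = {i, j, k} := by
    revert i j k; decide
  rw [h, Finset.sum_insert (by simp [hij, hik]), Finset.sum_insert (by simp [hjk]),
    Finset.sum_singleton, add_assoc]

namespace HexRelations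

variable {a p : Fin 3 → ℂ} {N N' : Matrix (Fin 3 × Fin 3) (Fin 3 × Fin 3) ℂ}

lemma sub_smul (h : HexRelations a p N) (h' : HexRelations a p N') (c : ℝ) :
    HexRelations a p (N' - (c : ℂ) • N) where
  herm x y := by simp [← h.herm x y, ← h'.herm x y]
  diag x k := by simp [h.diag, h'.diag]
  cross i j k := by simp [h.cross, h'.cross]
  sum_one x := by
    simp [Finset.sum_sub_distrib, ← Finset.mul_sum, h.sum_one, h'.sum_one]
  sum_vec x := by
    simp [sub_mul, mul_assoc, Finset.sum_sub_distrib, ← Finset.mul_sum, h.sum_vec, h'.sum_vec]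

lemma cross' (h : HexRelations a p N) (i j k : Fin 3) : N (i, k) (k, j) = 0 := by
  rw [← h.herm, h.cross, star_zero]

lemma sum_row (h : HexRelations a p N) {i j k : Fin 3} (hij : i ≠ j) (hik : i ≠ k)
    (hjk : j ≠ k) (w : Fin 3 × Fin 3 → ℂ) :
    ∑ y, N (i, j) y * w y = N (i, j) (i, j) * w (i, j) + N (i, j) (i, k) * w (i, k)
      + N (i, j) (k, j) * w (k, j) := by
  rw [Fintype.sum_prod_type]
  simp only [Fin.sum_univ_three_of_ne hij hik hjk, h.diag, h.cross, h.cross']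
  ring

lemma row_one (h : HexRelations a p N) {i j k : Fin 3} (hij : i ≠ j) (hik : i ≠ k)
    (hjk : j ≠ k) : N (i, j) (i, j) + N (i, j) (i, k) + N (i, j) (k, j) = 0 := by
  simpa [h.sum_one] using (h.sum_row hij hik hjk 1).symm

lemma row_vec (h : HexRelations a p N) {i j k : Fin 3} (hij : i ≠ j) (hik : i ≠ k)
    (hjk : j ≠ k) :
    N (i, j) (i, k) * (a i * (p k - p j)) + N (i, j) (k, j) * ((a k - a i) * p j) = 0 := by
  have h1 := h.row_one hij hik hjk
  have h2 := h.sum_row hij hik hjk (fun y => a y.1 * p y.2)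
  rw [h.sum_vec] at h2
  linear_combination -h2 - a i * p j * h1

lemma eq_zero_of_edge (h : HexRelations a p N) (ha : ∀ i, a i ≠ 0) (hp : ∀ i, p i ≠ 0)
    (ha' : Function.Injective a) (hp' : Function.Injective p) {i j k : Fin 3} (hij : i ≠ j)
    (hik : i ≠ k) (hjk : j ≠ k) (h0 : N (i, j) (i, k) = 0) : N = 0 := by
  have hPQ : ∀ {i j k : Fin 3}, i ≠ j → i ≠ k → j ≠ k → N (i, j) (i, k) = 0 →
      N (i, j) (k, j) = 0 := by
    intro i j k hij hik hjk h0
    have := h.row_vec hij hik hjk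
    rw [h0, zero_mul, zero_add] at this
    exact (mul_eq_zero.1 this).resolve_right
      (mul_ne_zero (sub_ne_zero.2 (ha'.ne hik.symm)) (hp j))
  have hQP : ∀ {i j k : Fin 3}, i ≠ j → i ≠ k → j ≠ k → N (i, j) (k, j) = 0 →
      N (i, j) (i, k) = 0 := by
    intro i j k hij hik hjk h0
    have := h.row_vec hij hik hjk
    rw [h0, zero_mul, add_zero] at this
    exact (mul_eq_zero.1 this).resolve_right
      (mul_ne_zero (ha i) (sub_ne_zero.2 (hp'.ne hjk.symm)))
  have swap₂₃ : ∀ {i j k : Fin 3}, N (i, j) (i, k) = 0 → N (i, k) (i, j) = 0 := by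
    intro i j k h0
    rw [← h.herm, h0, star_zero]
  have swap₁₃ : ∀ {i j k : Fin 3}, i ≠ j → i ≠ k → j ≠ k → N (i, j) (i, k) = 0 →
      N (k, j) (k, i) = 0 := by
    intro i j k hij hik hjk h0
    refine hQP hjk.symm hik.symm hij.symm ?_
    rw [← h.herm, hPQ hij hik hjk h0, star_zero]
  have hP : ∀ r s t : Fin 3, r ≠ s → r ≠ t → s ≠ t → N (r, s) (r, t) = 0 := by
    have h1 := swap₂₃ h0
    have h2 := swap₁₃ hij hik hjk h0
    have h3 := swap₂₃ h2
    have h4 := swap₁₃ hik hij hjk.symm h1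
    have h5 := swap₂₃ h4
    intro r s t hrs hrt hst
    have key : (r = i ∧ s = j ∧ t = k) ∨ (r = i ∧ s = k ∧ t = j) ∨ (r = k ∧ s = j ∧ t = i) ∨
        (r = k ∧ s = i ∧ t = j) ∨ (r = j ∧ s = k ∧ t = i) ∨ (r = j ∧ s = i ∧ t = k) := by
      clear h0 h1 h2 h3 h4 h5
      decide +revert
    rcases key with h | h | h | h | h | h <;> obtain ⟨rfl, rfl, rfl⟩ := h <;> assumption
  have hdiag : ∀ r s : Fin 3, N (r, s) (r, s) = 0 := by
    intro r s
    by_cases hrs : r = s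
    · rw [hrs, h.diag]
    · obtain ⟨t, hrt, hst⟩ : ∃ t, r ≠ t ∧ s ≠ t := by revert r s; decide
      have := h.row_one hrs hrt hst
      rwa [hP r s t hrs hrt hst, hPQ hrs hrt hst (hP r s t hrs hrt hst), add_zero,
        add_zero] at this
  ext ⟨r, s⟩ ⟨t, u⟩
  rw [Matrix.zero_apply]
  by_cases h1 : t = u
  · rw [h1, h.diag]
  by_cases h2 : r = s
  · rw [h2, ← h.herm, h.diag, star_zero]
  by_cases h3 : u = r
  · rw [h3, h.cross]
  by_cases h4 : s = t
  · rw [h4, h.cross']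
  by_cases h5 : t = r
  · subst h5
    by_cases h6 : u = s
    · rw [h6, hdiag]
    · exact hP _ _ _ h2 (Ne.symm h3) (Ne.symm h6)
  · obtain rfl : u = s := by clear h0; decide +revert
    exact hPQ h2 (Ne.symm h5) h4 (hP _ _ _ h2 (Ne.symm h5) h4)

lemma eq_zero_of_diag_zero (h : HexRelations a p N) (h' : HexRelations a p N')
    (ha : ∀ i, a i ≠ 0) (hp : ∀ i, p i ≠ 0) (ha' : Function.Injective a)
    (hp' : Function.Injective p) {v : Fin 3 × Fin 3} (hv : N v v ≠ 0) (hv' : N' v v = 0) :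
    N' = 0 := by
  obtain ⟨i, j⟩ := v
  have hij : i ≠ j := by
    rintro rfl
    exact hv (h.diag _ _)
  obtain ⟨k, hik, hjk⟩ : ∃ k, i ≠ k ∧ j ≠ k := by clear hv hv'; revert i j; decide
  refine h'.eq_zero_of_edge ha hp ha' hp' hij hik hjk ?_
  have e1 := h.row_one hij hik hjk
  have e2 := h.row_vec hij hik hjk
  have e1' := h'.row_one hij hik hjk
  have e2' := h'.row_vec hij hik hjk
  have hne : a i * p k - a k * p j ≠ 0 := by
    intro h0
    have : N (i, j) (i, j) * (a i * (p k - p j)) = 0 := by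
      linear_combination a i * (p k - p j) * e1 - e2 - N (i, j) (k, j) * h0
    exact hv ((mul_eq_zero.1 this).resolve_right
      (mul_ne_zero (ha i) (sub_ne_zero.2 (hp'.ne hjk.symm))))
  rw [hv'] at e1'
  have : N' (i, j) (i, k) * (a i * p k - a k * p j) = 0 := by
    linear_combination e2' - (a k - a i) * p j * e1'
  exact (mul_eq_zero.1 this).resolve_right hne

end HexRelations

lemma Matrix.PosSemidef.exists_diag_ne_zero {n : Type*} [Fintype n] [DecidableEq n]
    {M : Matrix n n ℂ} (hM : M.PosSemidef) (h0 : M ≠ 0) : ∃ v, M v v ≠ 0 := by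
  by_contra! h
  refine h0 ?_
  ext x y
  have := (hM.dotProduct_mulVec_zero_iff (Pi.single y 1)).1 (by simp [h])
  simpa using congrFun this x

lemma HexRelations.exists_pos_smul {a p : Fin 3 → ℂ}
    {N N' : Matrix (Fin 3 × Fin 3) (Fin 3 × Fin 3) ℂ} (h : HexRelations a p N)
    (h' : HexRelations a p N') (ha : ∀ i, a i ≠ 0) (hp : ∀ i, p i ≠ 0)
    (ha' : Function.Injective a) (hp' : Function.Injective p) (hN : N.PosSemidef)
    (hN' : N'.PosSemidef) (h0 : N ≠ 0) (h0' : N' ≠ 0) :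
    ∃ lam : ℝ, 0 < lam ∧ N' = (lam : ℂ) • N := by
  obtain ⟨v, hv⟩ := hN.exists_diag_ne_zero h0
  have hv' : N' v v ≠ 0 := fun h1 =>
    h0' (h.eq_zero_of_diag_zero h' ha hp ha' hp' hv h1)
  obtain ⟨d, hd, hd'⟩ : ∃ d : ℝ, 0 < d ∧ N v v = d := by
    have := lt_of_le_of_ne hN.diag_nonneg (Ne.symm hv)
    rw [Complex.lt_def] at this
    exact ⟨(N v v).re, this.1, Complex.ext rfl this.2.symm⟩
  obtain ⟨e, he, he'⟩ : ∃ e : ℝ, 0 < e ∧ N' v v = e := by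
    have := lt_of_le_of_ne hN'.diag_nonneg (Ne.symm hv')
    rw [Complex.lt_def] at this
    exact ⟨(N' v v).re, this.1, Complex.ext rfl this.2.symm⟩
  refine ⟨e / d, div_pos he hd, sub_eq_zero.1 ?_⟩
  refine h.eq_zero_of_diag_zero (h.sub_smul h' (e / d)) ha hp ha' hp' hv ?_
  have : (d : ℂ) ≠ 0 := by exact_mod_cast hd.ne'
  simp [hd', he', this]

lemma prodVec_single (k l : Fin 3) :
    prodVec (Pi.single k 1) (Pi.single l 1) = (Pi.single (k, l) 1 : Fin 3 × Fin 3 → ℂ) := by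
  ext ⟨i, j⟩
  by_cases hi : i = k <;> by_cases hj : j = l <;> simp [prodVec, hi, hj]

lemma Matrix.PosSemidef.hexRelations {a p : Fin 3 → ℂ}
    {N : Matrix (Fin 3 × Fin 3) (Fin 3 × Fin 3) ℂ} (hN : N.PosSemidef) (hT : (pt N).PosSemidef)
    (hk : ∀ k, N *ᵥ prodVec (Pi.single k 1) (Pi.single k 1) = 0)
    (h1 : N *ᵥ prodVec 1 1 = 0) (hv : N *ᵥ prodVec a p = 0) : HexRelations a p N where
  herm x y := hN.isHermitian.apply x y
  diag x k := by
    have := congrFun (hk k) x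
    simpa [prodVec_single] using this
  cross i j k := by
    have h0 : N (k, k) (k, k) = 0 := by
      simpa [prodVec_single] using congrFun (hk k) (k, k)
    have := (hT.dotProduct_mulVec_zero_iff (Pi.single (k, k) 1)).1 (by simp [pt, h0])
    simpa [pt] using congrFun this (i, j)
  sum_one x := by
    simpa [mulVec, dotProduct, prodVec] using congrFun h1 x
  sum_vec x := by
    simpa [mulVec, dotProduct, prodVec] using congrFun hv x

open scoped Kronecker

lemma kronecker_mulVec_prodVec (A B : Matrix (Fin 3) (Fin 3) ℂ) (f g : Fin 3 → ℂ) :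
    (A ⊗ₖ B) *ᵥ prodVec f g = prodVec (A *ᵥ f) (B *ᵥ g) := by
  ext ⟨i, j⟩
  simp only [prodVec, mulVec, dotProduct, Fintype.sum_prod_type, kroneckerMap_apply,
    Finset.sum_mul_sum]
  exact Finset.sum_congr rfl fun _ _ => Finset.sum_congr rfl fun _ _ => by ring

lemma pt_conj_kronecker (A B : Matrix (Fin 3) (Fin 3) ℂ)
    (ρ : Matrix (Fin 3 × Fin 3) (Fin 3 × Fin 3) ℂ) :
    pt ((A ⊗ₖ B)ᴴ * ρ * (A ⊗ₖ B)) =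
      (A.map star ⊗ₖ B)ᴴ * pt ρ * (A.map star ⊗ₖ B) := by
  ext ⟨i, j⟩ ⟨k, l⟩
  simp only [pt, of_apply, mul_apply, conjTranspose_apply, kroneckerMap_apply, map_apply,
    Fintype.sum_prod_type, Fin.sum_univ_three, star_mul', star_star]
  ring

/-- Any three of the vectors are linearly independent. -/
def GeneralPosition (φ : Fin 5 → Fin 3 → ℂ) : Prop :=
  ∀ i j k, i ≠ j → i ≠ k → j ≠ k → LinearIndependent ℂ ![φ i, φ j, φ k]

lemma GeneralPosition.eq_zero {φ : Fin 5 → Fin 3 → ℂ} (h : GeneralPosition φ) {i j k : Fin 5}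
    (hij : i ≠ j) (hik : i ≠ k) (hjk : j ≠ k) {c d e : ℂ}
    (h0 : c • φ i + d • φ j + e • φ k = 0) : c = 0 ∧ d = 0 ∧ e = 0 := by
  have := Fintype.linearIndependent_iff.1 (h i j k hij hik hjk) ![c, d, e]
    (by simpa [Fin.sum_univ_three] using h0)
  exact ⟨this 0, this 1, this 2⟩

lemma GeneralPosition.exists_normal_form {φ : Fin 5 → Fin 3 → ℂ} (h : GeneralPosition φ) :
    ∃ (A : Matrix (Fin 3) (Fin 3) ℂ) (c a : Fin 3 → ℂ), IsUnit A ∧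
      (∀ k, A *ᵥ Pi.single k 1 = c k • φ (Fin.castLE (by norm_num) k)) ∧
      A *ᵥ 1 = φ 3 ∧ A *ᵥ a = φ 4 ∧ (∀ i, a i ≠ 0) ∧ Function.Injective a := by
  set A₀ : Matrix (Fin 3) (Fin 3) ℂ := (Matrix.of ![φ 0, φ 1, φ 2])ᵀ with hA₀
  have hmul : ∀ x : Fin 3 → ℂ, A₀ *ᵥ x = x 0 • φ 0 + x 1 • φ 1 + x 2 • φ 2 := by
    intro x
    ext i
    simp [hA₀, mulVec, dotProduct, Fin.sum_univ_three, mul_comm]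
  have hu : IsUnit A₀ := by
    rw [hA₀, isUnit_transpose]
    exact linearIndependent_rows_iff_isUnit.1 (h 0 1 2 (by decide) (by decide) (by decide))
  have hsolve : ∀ {A : Matrix (Fin 3) (Fin 3) ℂ}, IsUnit A → ∀ y, ∃ x, A *ᵥ x = y :=
    fun hA => mulVec_surjective_iff_isUnit.2 hA
  obtain ⟨c, hc⟩ := hsolve hu (φ 3)
  rw [hmul] at hc
  have hc0 : ∀ k, c k ≠ 0 := by
    intro k hk
    have h1 : (-1 : ℂ) ≠ 0 := by norm_num
    fin_cases k <;> simp only [Fin.zero_eta, Fin.mk_one, Fin.reduceFinMk] at hk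
    · exact h1 (h.eq_zero (i := 1) (j := 2) (k := 3) (by decide) (by decide) (by decide)
        (c := c 1) (d := c 2) (e := -1) (by rw [← hc, hk]; module)).2.2
    · exact h1 (h.eq_zero (i := 0) (j := 2) (k := 3) (by decide) (by decide) (by decide)
        (c := c 0) (d := c 2) (e := -1) (by rw [← hc, hk]; module)).2.2
    · exact h1 (h.eq_zero (i := 0) (j := 1) (k := 3) (by decide) (by decide) (by decide)
        (c := c 0) (d := c 1) (e := -1) (by rw [← hc, hk]; module)).2.2
  have hA : IsUnit (A₀ * diagonal c) :=
    hu.mul (by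
      rw [isUnit_iff_isUnit_det, det_diagonal, isUnit_iff_ne_zero]
      exact Finset.prod_ne_zero_iff.2 fun k _ => hc0 k)
  obtain ⟨a, ha⟩ := hsolve hA (φ 4)
  have hmul' : ∀ x : Fin 3 → ℂ, (A₀ * diagonal c) *ᵥ x =
      (c 0 * x 0) • φ 0 + (c 1 * x 1) • φ 1 + (c 2 * x 2) • φ 2 := by
    intro x
    rw [← mulVec_mulVec, hmul]
    simp [mulVec_diagonal]
  refine ⟨A₀ * diagonal c, c, a, hA, ?_, ?_, ha, ?_, ?_⟩
  · intro k
    rw [hmul']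
    fin_cases k <;> simp
  · rw [hmul', ← hc]
    simp
  · rw [hmul'] at ha
    intro k hk
    have h1 : (-1 : ℂ) ≠ 0 := by norm_num
    fin_cases k <;> simp only [Fin.zero_eta, Fin.mk_one, Fin.reduceFinMk] at hk
    · exact h1 (h.eq_zero (i := 1) (j := 2) (k := 4) (by decide) (by decide) (by decide)
        (c := c 1 * a 1) (d := c 2 * a 2) (e := -1) (by rw [← ha, hk]; module)).2.2
    · exact h1 (h.eq_zero (i := 0) (j := 2) (k := 4) (by decide) (by decide) (by decide)
        (c := c 0 * a 0) (d := c 2 * a 2) (e := -1) (by rw [← ha, hk]; module)).2.2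
    · exact h1 (h.eq_zero (i := 0) (j := 1) (k := 4) (by decide) (by decide) (by decide)
        (c := c 0 * a 0) (d := c 1 * a 1) (e := -1) (by rw [← ha, hk]; module)).2.2
  · rw [hmul'] at ha
    have h1 : (-1 : ℂ) ≠ 0 := by norm_num
    have h01 : a 0 ≠ a 1 := fun hk =>
      h1 (h.eq_zero (i := 2) (j := 3) (k := 4) (by decide) (by decide) (by decide)
        (c := c 2 * (a 2 - a 1)) (d := a 1) (e := -1) (by rw [← ha, ← hc, hk]; module)).2.2
    have h02 : a 0 ≠ a 2 := fun hk =>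
      h1 (h.eq_zero (i := 1) (j := 3) (k := 4) (by decide) (by decide) (by decide)
        (c := c 1 * (a 1 - a 2)) (d := a 2) (e := -1) (by rw [← ha, ← hc, hk]; module)).2.2
    have h12 : a 1 ≠ a 2 := fun hk =>
      h1 (h.eq_zero (i := 0) (j := 3) (k := 4) (by decide) (by decide) (by decide)
        (c := c 0 * (a 0 - a 2)) (d := a 2) (e := -1) (by rw [← ha, ← hc, hk]; module)).2.2
    intro i j hij
    fin_cases i <;> fin_cases j <;> simp_all

lemma hinner_prodVec (a b f g : Fin 3 → ℂ) :
    hinner (prodVec a b) (prodVec f g) = hinner a f * hinner b g := by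
  simp only [hinner, prodVec, Fintype.sum_prod_type, Finset.sum_mul_sum, map_mul]
  exact Finset.sum_congr rfl fun _ _ => Finset.sum_congr rfl fun _ _ => by ring

lemma exists_hinner_eq_zero {u : Fin 3 → Fin 3 → ℂ} (hu : ¬ LinearIndependent ℂ u) :
    ∃ f : Fin 3 → ℂ, f ≠ 0 ∧ ∀ i, hinner (u i) f = 0 := by
  have hdet : (Matrix.of u).det = 0 := by
    by_contra h
    exact hu (linearIndependent_rows_iff_isUnit.2
      ((isUnit_iff_isUnit_det _).2 (isUnit_iff_ne_zero.2 h)))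
  have hdet' : ((Matrix.of u).map star).det = 0 := by
    have := det_conjTranspose (Matrix.of u)
    rw [hdet, star_zero, conjTranspose, transpose_map, det_transpose] at this
    exact this
  obtain ⟨f, hf, h⟩ := exists_mulVec_eq_zero_iff.2 hdet'
  exact ⟨f, hf, fun i => congrFun h i⟩

lemma not_linearIndependent_of_repeat (u v : Fin 3 → ℂ) :
    ¬ LinearIndependent ℂ ![u, v, v] := fun h => by
  have := h.injective (a₁ := 1) (a₂ := 2) rfl
  simp at this

/-- Two families of five vectors whose products have no common orthogonal product vector are
in general position on the first side. -/
lemma generalPosition_of_unextendible {φ ψ : Fin 5 → Fin 3 → ℂ}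
    (h : ¬ ∃ f g : Fin 3 → ℂ, f ≠ 0 ∧ g ≠ 0 ∧ ∀ i, hinner (φ i) f * hinner (ψ i) g = 0) :
    GeneralPosition φ := by
  intro i j k hij hik hjk
  by_contra hdep
  obtain ⟨l, m, hlm⟩ : ∃ l m : Fin 5, ∀ x, x = i ∨ x = j ∨ x = k ∨ x = l ∨ x = m := by
    clear hdep h
    revert i j k
    decide
  obtain ⟨f, hf, hf'⟩ := exists_hinner_eq_zero hdep
  obtain ⟨g, hg, hg'⟩ := exists_hinner_eq_zero (not_linearIndependent_of_repeat (ψ l) (ψ m))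
  have hf0 : hinner (φ i) f = 0 := hf' 0
  have hf1 : hinner (φ j) f = 0 := hf' 1
  have hf2 : hinner (φ k) f = 0 := hf' 2
  have hg0 : hinner (ψ l) g = 0 := hg' 0
  have hg1 : hinner (ψ m) g = 0 := hg' 1
  refine h ⟨f, g, hf, hg, fun x => ?_⟩
  rcases hlm x with rfl | rfl | rfl | rfl | rfl <;> simp [*]

lemma prodVec_smul_smul (c d : ℂ) (f g : Fin 3 → ℂ) :
    prodVec (c • f) (d • g) = (c * d) • prodVec f g := by
  ext x
  simp only [prodVec, Pi.smul_apply, smul_eq_mul]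
  ring

theorem stmt17 (φ ψ : Fin 5 → Fin 3 → ℂ)
    (hφ : ∀ i, φ i ≠ 0) (hψ : ∀ i, ψ i ≠ 0)
    (hgUPB : ¬ ∃ (f g : Fin 3 → ℂ), f ≠ 0 ∧ g ≠ 0 ∧
      ∀ i, hinner (prodVec (φ i) (ψ i)) (prodVec f g) = 0)
    (ρ₁ ρ₂ : Matrix (Fin 3 × Fin 3) (Fin 3 × Fin 3) ℂ)
    (hne₁ : ρ₁ ≠ 0) (hpsd₁ : ρ₁.PosSemidef) (hppt₁ : (pt ρ₁).PosSemidef)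
    (hne₂ : ρ₂ ≠ 0) (hpsd₂ : ρ₂.PosSemidef) (hppt₂ : (pt ρ₂).PosSemidef)
    (hker₁ : ∀ i, ρ₁.mulVec (prodVec (φ i) (ψ i)) = 0)
    (hker₂ : ∀ i, ρ₂.mulVec (prodVec (φ i) (ψ i)) = 0) :
    ∃ lam : ℝ, 0 < lam ∧ ρ₂ = (lam : ℂ) • ρ₁ := by
  simp only [hinner_prodVec] at hgUPB
  have hgφ : GeneralPosition φ := generalPosition_of_unextendible hgUPB
  have hgψ : GeneralPosition ψ := generalPosition_of_unextendible (ψ := φ) (by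
    rintro ⟨g, f, hg, hf, h⟩
    exact hgUPB ⟨f, g, hf, hg, fun i => by rw [mul_comm, h i]⟩)
  obtain ⟨A, c, a, hA, hAk, hA1, hAa, ha, ha'⟩ := hgφ.exists_normal_form
  obtain ⟨B, d, p, hB, hBk, hB1, hBp, hp, hp'⟩ := hgψ.exists_normal_form
  have hC : IsUnit (A ⊗ₖ B) := by
    rw [isUnit_iff_isUnit_det] at hA hB ⊢
    rw [det_kronecker]
    exact (hA.pow _).mul (hB.pow _)
  have hinj : ∀ ρ ρ' : Matrix (Fin 3 × Fin 3) (Fin 3 × Fin 3) ℂ,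
      (A ⊗ₖ B)ᴴ * ρ * (A ⊗ₖ B) = (A ⊗ₖ B)ᴴ * ρ' * (A ⊗ₖ B) → ρ = ρ' := fun ρ ρ' h =>
    hC.star.mul_left_cancel (hC.mul_right_cancel h)
  have hne : ∀ ρ : Matrix (Fin 3 × Fin 3) (Fin 3 × Fin 3) ℂ, ρ ≠ 0 →
      (A ⊗ₖ B)ᴴ * ρ * (A ⊗ₖ B) ≠ 0 := fun ρ h h0 => h (hinj ρ 0 (by simpa using h0))
  have hex : ∀ ρ : Matrix (Fin 3 × Fin 3) (Fin 3 × Fin 3) ℂ, ρ.PosSemidef →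
      (pt ρ).PosSemidef → (∀ i, ρ *ᵥ prodVec (φ i) (ψ i) = 0) →
      HexRelations a p ((A ⊗ₖ B)ᴴ * ρ * (A ⊗ₖ B)) := by
    intro ρ hρ hT hk
    refine (hρ.conjTranspose_mul_mul_same _).hexRelations ?_ (fun k => ?_) ?_ ?_
    · rw [pt_conj_kronecker]
      exact hT.conjTranspose_mul_mul_same _
    all_goals rw [← mulVec_mulVec, ← mulVec_mulVec, kronecker_mulVec_prodVec]
    · rw [hAk, hBk, prodVec_smul_smul, mulVec_smul, hk, smul_zero, mulVec_zero]
    · rw [hA1, hB1, hk, mulVec_zero]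
    · rw [hAa, hBp, hk, mulVec_zero]
  obtain ⟨lam, hlam, h⟩ := (hex ρ₁ hpsd₁ hppt₁ hker₁).exists_pos_smul
    (hex ρ₂ hpsd₂ hppt₂ hker₂) ha hp ha' hp' (hpsd₁.conjTranspose_mul_mul_same _)
    (hpsd₂.conjTranspose_mul_mul_same _) (hne ρ₁ hne₁) (hne ρ₂ hne₂)
  exact ⟨lam, hlam, hinj _ _ (by rw [h]; simp)⟩
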